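/- arXiv:1303.6093 — 2 statements merged into one kernel-verified Lean document; each statement's English description precedes it below -/
import Mathlib

section
/- Let θ₁, θ₂ be real numbers such that 1, θ₁, θ₂ are linearly independent over ℤ, let L(x) = x₀ + x₁θ₁ + x₂θ₂, and let (x_ν) be the sequence of minimal points of L with X_ν = |x_ν| and L_ν = L(x_ν). Let α > 2 and suppose L_j ≤ X_{j+1}^{−α} for all sufficiently large j. Then there exist a constant C > 0 and an index J such that for every j ≥ J for which x_{j−1}, x_j, x_{j+1} are linearly independent, one has L_j ≤ C·X_j^{−α(α−1)}. -/
/-- Euclidean norm of an integer vector in `ℤ³`. -/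
noncomputable def enormZ (v : Fin 3 → ℤ) : ℝ :=
  Real.sqrt ((v 0 : ℝ) ^ 2 + (v 1 : ℝ) ^ 2 + (v 2 : ℝ) ^ 2)

/-- The rational vector associated to an integer vector. -/
def toQ (v : Fin 3 → ℤ) : Fin 3 → ℚ := fun i => (v i : ℚ)

/-- The value of the linear form `L(x) = x₀ + x₁ θ₁ + x₂ θ₂` at an integer vector. -/
noncomputable def Lv (θ₁ θ₂ : ℝ) (v : Fin 3 → ℤ) : ℝ :=
  (v 0 : ℝ) + (v 1 : ℝ) * θ₁ + (v 2 : ℝ) * θ₂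

theorem abs_apply_le_enormZ (v : Fin 3 → ℤ) (i : Fin 3) : |(v i : ℝ)| ≤ enormZ v := by
  apply Real.abs_le_sqrt
  fin_cases i <;> simp <;> nlinarith [sq_nonneg (v 0 : ℝ), sq_nonneg (v 1 : ℝ), sq_nonneg (v 2 : ℝ)]

theorem enormZ_pos {v : Fin 3 → ℤ} (hv : v ≠ 0) : 0 < enormZ v := by
  obtain ⟨i, hi⟩ := Function.ne_iff.mp hv
  have hi' : (v i : ℝ) ≠ 0 := by exact_mod_cast hi
  exact (abs_pos.mpr hi').trans_le (abs_apply_le_enormZ v i)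

theorem abs_minor_le (u v : Fin 3 → ℤ) :
    |(u 1 : ℝ) * v 2 - u 2 * v 1| ≤ 2 * (enormZ u * enormZ v) := by
  have key (i k : Fin 3) : |(u i : ℝ) * v k| ≤ enormZ u * enormZ v := by
    rw [abs_mul]
    exact mul_le_mul (abs_apply_le_enormZ u i) (abs_apply_le_enormZ v k) (abs_nonneg _)
      (Real.sqrt_nonneg _)
  linarith [abs_sub ((u 1 : ℝ) * v 2) (u 2 * v 1), key 1 2, key 2 1]

/-- The integer determinant of three independent vectors, expanded along the values of `L`. -/
theorem one_le_abs_det_of_linearIndependent (θ₁ θ₂ : ℝ) {a b c : Fin 3 → ℤ}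
    (h : LinearIndependent ℚ ![toQ a, toQ b, toQ c]) :
    1 ≤ |Lv θ₁ θ₂ a * (b 1 * c 2 - b 2 * c 1) - Lv θ₁ θ₂ b * (a 1 * c 2 - a 2 * c 1)
      + Lv θ₁ θ₂ c * (a 1 * b 2 - a 2 * b 1)| := by
  let D : ℤ := a 0 * (b 1 * c 2 - b 2 * c 1) - b 0 * (a 1 * c 2 - a 2 * c 1)
    + c 0 * (a 1 * b 2 - a 2 * b 1)
  have hD : D ≠ 0 := by
    intro h0
    have hu := (Matrix.linearIndependent_rows_iff_isUnit
      (A := Matrix.of ![toQ a, toQ b, toQ c])).mp h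
    rw [Matrix.isUnit_iff_isUnit_det, isUnit_iff_ne_zero] at hu
    apply hu
    have h0' : (D : ℚ) = 0 := by exact_mod_cast h0
    simp only [D] at h0'
    push_cast at h0'
    simp [Matrix.det_fin_three, toQ]
    linarith
  have h1 : (1 : ℝ) ≤ |(D : ℝ)| := by exact_mod_cast Int.one_le_abs hD
  convert h1 using 2
  simp only [D, Lv]
  push_cast
  ring

theorem one_le_of_linearIndependent {θ₁ θ₂ : ℝ} {a b c : Fin 3 → ℤ}
    (h : LinearIndependent ℚ ![toQ a, toQ b, toQ c])
    (hc : 0 < Lv θ₁ θ₂ c) (hcb : Lv θ₁ θ₂ c < Lv θ₁ θ₂ b) (hba : Lv θ₁ θ₂ b < Lv θ₁ θ₂ a)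
    (hab : enormZ a < enormZ b) (hbc : enormZ b < enormZ c) :
    1 ≤ 6 * (Lv θ₁ θ₂ a * (enormZ b * enormZ c)) := by
  have hdet := one_le_abs_det_of_linearIndependent θ₁ θ₂ h
  have hapos : 0 ≤ enormZ a := Real.sqrt_nonneg _
  have term {l m p : ℝ} (hl : 0 < l) (hla : l ≤ Lv θ₁ θ₂ a) (hm : |m| ≤ 2 * p)
      (hp : p ≤ enormZ b * enormZ c) :
      |l * m| ≤ 2 * (Lv θ₁ θ₂ a * (enormZ b * enormZ c)) := by
    rw [abs_mul, abs_of_pos hl]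
    calc l * |m| ≤ Lv θ₁ θ₂ a * (2 * (enormZ b * enormZ c)) :=
          mul_le_mul hla (by linarith) (abs_nonneg _) (by linarith)
      _ = _ := by ring
  have t1 := term (by linarith) le_rfl (abs_minor_le b c) le_rfl
  have t2 := term (by linarith) hba.le (abs_minor_le a c) (by gcongr; linarith)
  have t3 := term hc (by linarith) (abs_minor_le a b) (by nlinarith)
  have s1 := abs_add_le
    (Lv θ₁ θ₂ a * (b 1 * c 2 - b 2 * c 1) - Lv θ₁ θ₂ b * (a 1 * c 2 - a 2 * c 1))
    (Lv θ₁ θ₂ c * (a 1 * b 2 - a 2 * b 1))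
  have s2 := abs_sub (Lv θ₁ θ₂ a * ((b 1 : ℝ) * c 2 - b 2 * c 1))
    (Lv θ₁ θ₂ b * (a 1 * c 2 - a 2 * c 1))
  linarith

/-- Jarník's inequality: if `α > 2` and `L_j ≤ X_{j+1}^{−α}` for all sufficiently large `j`,
then for all sufficiently large `j` with `x_{j−1}, x_j, x_{j+1}` linearly independent one has
`L_j ≤ C·X_j^{−α(α−1)}` for a positive constant `C`. -/
theorem jarnik_L_decay (θ₁ θ₂ : ℝ)
    (hind : ∀ a b c : ℤ, (a : ℝ) + (b : ℝ) * θ₁ + (c : ℝ) * θ₂ = 0 → a = 0 ∧ b = 0 ∧ c = 0)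
    -- `x` is the sequence of minimal points (best approximations) of `L`:
    (x : ℕ → Fin 3 → ℤ)
    (hx0 : ∀ ν, x ν ≠ 0)
    (hLpos : ∀ ν, 0 < Lv θ₁ θ₂ (x ν))
    (hXlt : ∀ ν, enormZ (x ν) < enormZ (x (ν + 1)))
    (hLlt : ∀ ν, Lv θ₁ θ₂ (x (ν + 1)) < Lv θ₁ θ₂ (x ν))
    (hbest : ∀ ν, ∀ y : Fin 3 → ℤ, y ≠ 0 → enormZ y < enormZ (x (ν + 1)) →
      Lv θ₁ θ₂ (x ν) ≤ |Lv θ₁ θ₂ y|)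
    (α : ℝ) (hα : 2 < α)
    (hsii : ∃ J₀ : ℕ, ∀ j, J₀ ≤ j → Lv θ₁ θ₂ (x j) ≤ enormZ (x (j + 1)) ^ (-α)) :
    ∃ C > (0 : ℝ), ∃ J : ℕ, ∀ j, J ≤ j →
      LinearIndependent ℚ ![toQ (x (j - 1)), toQ (x j), toQ (x (j + 1))] →
      Lv θ₁ θ₂ (x j) ≤ C * enormZ (x j) ^ (-(α * (α - 1))) := by
  obtain ⟨J₀, hJ₀⟩ := hsii
  refine ⟨6 ^ α, by positivity, J₀ + 1, fun j hj hli => ?_⟩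
  obtain ⟨k, rfl⟩ : ∃ k, j = k + 1 := ⟨j - 1, by omega⟩
  rw [Nat.add_sub_cancel] at hli
  have hdet := one_le_of_linearIndependent hli (hLpos _) (hLlt _) (hLlt _) (hXlt _) (hXlt _)
  have hX := enormZ_pos (hx0 (k + 1))
  have hY := enormZ_pos (hx0 (k + 1 + 1))
  have hk := hJ₀ k (by omega)
  have hk1 := hJ₀ (k + 1) (by omega)
  set X := enormZ (x (k + 1))
  set Y := enormZ (x (k + 1 + 1))
  have hgrow : X ^ (α - 1) / 6 ≤ Y := by
    have h1 : 1 ≤ 6 * (X ^ (-α) * (X * Y)) := hdet.trans (by gcongr)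
    have h2 : X ^ (α - 1) * (X ^ (-α) * X) = 1 := by
      rw [← Real.rpow_add_one hX.ne', ← Real.rpow_add hX]
      simp
    have h3 := mul_le_mul_of_nonneg_left h1 (Real.rpow_nonneg hX.le (α - 1))
    have h4 : X ^ (α - 1) * (6 * (X ^ (-α) * (X * Y))) = 6 * Y := by
      linear_combination 6 * Y * h2
    linarith
  calc Lv θ₁ θ₂ (x (k + 1)) ≤ Y ^ (-α) := hk1
    _ ≤ (X ^ (α - 1) / 6) ^ (-α) :=
      Real.rpow_le_rpow_of_nonpos (by positivity) hgrow (by linarith)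
    _ = 6 ^ α * X ^ (-(α * (α - 1))) := by
      rw [Real.div_rpow (by positivity) (by norm_num), ← Real.rpow_mul hX.le,
        Real.rpow_neg (by norm_num : (0 : ℝ) ≤ 6), div_inv_eq_mul, mul_comm]
      ring_nf
end

section
/- Let θ₁, θ₂ be real numbers such that 1, θ₁, θ₂ are linearly independent over ℤ, let L(x) = x₀ + x₁θ₁ + x₂θ₂, and let (x_ν) be the sequence of minimal points of L. Then each minimal point x_j is a primitive vector of ℤ³ (the gcd of its coordinates is 1), and each consecutive pair x_j, x_{j+1} forms a basis of the two-dimensional lattice ℤ³ ∩ span(x_j, x_{j+1}), i.e. every point of ℤ³ lying in the real linear span of x_j and x_{j+1} is an integer linear combination of x_j and x_{j+1}. -/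
/-- The real vector associated to an integer vector. -/
def toR (v : Fin 3 → ℤ) : Fin 3 → ℝ := fun i => (v i : ℝ)

/-- The linear form `L(x) = x₀ + x₁ θ₁ + x₂ θ₂` on `ℝ³`. -/
noncomputable def Lform (θ₁ θ₂ : ℝ) : (Fin 3 → ℝ) →ₗ[ℝ] ℝ :=
  LinearMap.proj 0 + θ₁ • LinearMap.proj 1 + θ₂ • LinearMap.proj 2

theorem enormZ_eq_norm (v : Fin 3 → ℤ) : enormZ v = ‖WithLp.toLp 2 (toR v)‖ := by
  simp [enormZ, toR, EuclideanSpace.norm_eq, Fin.sum_univ_three]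

theorem enormZ_le_of_toR_eq {z u v : Fin 3 → ℤ} {s t : ℝ}
    (h : toR z = s • toR u + t • toR v) :
    enormZ z ≤ |s| * enormZ u + |t| * enormZ v := by
  simp only [enormZ_eq_norm, h, WithLp.toLp_add, WithLp.toLp_smul]
  refine (norm_add_le _ _).trans ?_
  simp [norm_smul]

theorem abs_map_le_of_toR_eq (f : (Fin 3 → ℝ) →ₗ[ℝ] ℝ) {z u v : Fin 3 → ℤ} {s t : ℝ}
    (h : toR z = s • toR u + t • toR v) :
    |f (toR z)| ≤ |s| * |f (toR u)| + |t| * |f (toR v)| := by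
  rw [h, map_add, map_smul, map_smul, smul_eq_mul, smul_eq_mul, ← abs_mul, ← abs_mul]
  exact abs_add_le _ _

/-- A nonzero integer vector cannot be a real combination of two consecutive minimal points
with both coefficients at most `1 / 2` in absolute value. -/
theorem eq_zero_of_toR_eq_of_abs_le_half (f : (Fin 3 → ℝ) →ₗ[ℝ] ℝ) {u v z : Fin 3 → ℤ}
    (hv : 0 < f (toR v)) (hX : enormZ u < enormZ v)
    (hL : f (toR v) < f (toR u))
    (hbest : ∀ y : Fin 3 → ℤ, y ≠ 0 → enormZ y < enormZ v → f (toR u) ≤ |f (toR y)|)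
    {s t : ℝ} (h : toR z = s • toR u + t • toR v) (hs : |s| ≤ 1 / 2) (ht : |t| ≤ 1 / 2) :
    z = 0 := by
  by_contra hz
  have hu0 : 0 ≤ enormZ u := Real.sqrt_nonneg _
  have hnorm := enormZ_le_of_toR_eq h
  have habs := abs_map_le_of_toR_eq f h
  rw [abs_of_pos hv, abs_of_pos (hv.trans hL)] at habs
  have := hbest z hz (by nlinarith)
  nlinarith

/-- The vector `u` is primitive if no nonzero integer vector is a multiple of `u` by a real
factor of absolute value at most `1 / 2`. -/
theorem gcd_eq_one_of_forall_toR_eq_smul {u : Fin 3 → ℤ} (hu : u ≠ 0)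
    (H : ∀ (z : Fin 3 → ℤ) (s : ℝ), toR z = s • toR u → |s| ≤ 1 / 2 → z = 0) :
    Int.gcd (u 0) (Int.gcd (u 1) (u 2)) = 1 := by
  set d := Int.gcd (u 0) (Int.gcd (u 1) (u 2)) with hd
  have h12 : (d : ℤ) ∣ (Int.gcd (u 1) (u 2) : ℤ) := Int.gcd_dvd_right ..
  have hdvd : ∀ i, (d : ℤ) ∣ u i := by
    intro i
    fin_cases i
    · exact Int.gcd_dvd_left ..
    · exact h12.trans (Int.gcd_dvd_left ..)
    · exact h12.trans (Int.gcd_dvd_right ..)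
  choose z hz using hdvd
  have hd0 : d ≠ 0 := by
    intro h0
    apply hu
    funext i
    simp [hz i, h0]
  by_contra hd1
  have hd2 : (2 : ℝ) ≤ d := by exact_mod_cast (by omega : 2 ≤ d)
  have hz0 : z = 0 := by
    refine H z (d : ℝ)⁻¹ ?_ ?_
    · funext i
      have : (d : ℝ) ≠ 0 := by exact_mod_cast hd0
      simp [toR, hz i, this]
    · rw [abs_of_nonneg (by positivity), one_div]
      exact inv_anti₀ two_pos hd2
  apply hu
  funext i
  simp [hz i, hz0]

/-- Each minimal point `x_j` of `L(x) = x₀ + x₁θ₁ + x₂θ₂` (with `1, θ₁, θ₂` linearly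
independent over `ℤ`) is a primitive vector of `ℤ³`, and each consecutive pair
`x_j, x_{j+1}` is a basis of the two-dimensional lattice `ℤ³ ∩ span(x_j, x_{j+1})`: every
integer vector in the real span of `x_j` and `x_{j+1}` is an integer linear combination
of `x_j` and `x_{j+1}`. -/
theorem minimal_points_primitive_and_basis (θ₁ θ₂ : ℝ)
    (hind : ∀ a b c : ℤ, (a : ℝ) + (b : ℝ) * θ₁ + (c : ℝ) * θ₂ = 0 → a = 0 ∧ b = 0 ∧ c = 0)
    -- `x` is the sequence of minimal points (best approximations) of `L`:
    (x : ℕ → Fin 3 → ℤ)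
    (hx0 : ∀ ν, x ν ≠ 0)
    (hLpos : ∀ ν, 0 < Lform θ₁ θ₂ (toR (x ν)))
    (hXlt : ∀ ν, enormZ (x ν) < enormZ (x (ν + 1)))
    (hLlt : ∀ ν, Lform θ₁ θ₂ (toR (x (ν + 1))) < Lform θ₁ θ₂ (toR (x ν)))
    (hbest : ∀ ν, ∀ y : Fin 3 → ℤ, y ≠ 0 → enormZ y < enormZ (x (ν + 1)) →
      Lform θ₁ θ₂ (toR (x ν)) ≤ |Lform θ₁ θ₂ (toR y)|)
    : ∀ j : ℕ,
      Int.gcd (x j 0) (Int.gcd (x j 1) (x j 2)) = 1 ∧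
      ∀ y : Fin 3 → ℤ, toR y ∈ Submodule.span ℝ {toR (x j), toR (x (j + 1))} →
        ∃ a b : ℤ, y = a • x j + b • x (j + 1) := by
  intro j
  have key := fun (z : Fin 3 → ℤ) (s t : ℝ) =>
    eq_zero_of_toR_eq_of_abs_le_half (z := z) (s := s) (t := t) (Lform θ₁ θ₂)
      (hLpos (j + 1)) (hXlt j) (hLlt j) (hbest j)
  refine ⟨gcd_eq_one_of_forall_toR_eq_smul (hx0 j) fun z s hz hs => ?_, fun y hy => ?_⟩
  · exact key z s 0 (by simpa using hz) hs (by norm_num)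
  · obtain ⟨s, t, hst⟩ := Submodule.mem_span_pair.1 hy
    refine ⟨round s, round t, sub_eq_zero.1 ?_⟩
    refine key _ (s - round s) (t - round t) ?_ (abs_sub_round s) (abs_sub_round t)
    funext i
    have hi := congrFun hst i
    simp only [toR, Pi.add_apply, Pi.sub_apply, Pi.smul_apply, smul_eq_mul, Int.cast_sub,
      Int.cast_add, Int.cast_mul] at hi ⊢
    linear_combination -hi
end
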